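/- arXiv:1807.05820 — 2 statements merged into one kernel-verified Lean document; each statement's English description precedes it below -/
import Mathlib

section
/- Fix an integer n ≥ 3. Let k_n denote the (n−1)-dimensional Lebesgue measure of the region {(x₁,…,x_{n−1}) ∈ ℝ^{n−1} : |x_i| ≤ 1 for 1 ≤ i ≤ n−1 and |x₁ + ⋯ + x_{n−1}| ≤ 1}, and set c_n = 2ⁿ(ζ(n−1) − 1) + 2^{n−1} + 2k_n, where ζ is the Riemann zeta function. Then there exists a constant C > 0 (depending on n) such that for all real H ≥ 2 one has |R_n(H) − c_n·H^{n−1}| ≤ C·H^{n−2}(log H)². -/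
open Polynomial

namespace ReducibleCount

open Finset

/-- Integer vectors of length `m` with entries bounded by `N` in absolute value. -/
noncomputable def box (m N : ℕ) : Finset (Fin m → ℤ) := Fintype.piFinset fun _ => Icc (-(N : ℤ)) N

lemma mem_box {m N : ℕ} {b : Fin m → ℤ} : b ∈ box m N ↔ ∀ i, |b i| ≤ N := by
  simp [box, abs_le]

lemma card_box (m N : ℕ) : #(box m N) = (2 * N + 1) ^ m := by
  rw [box, Fintype.card_piFinset_const, Int.card_Icc]
  congr 1
  omega

lemma abs_card_filter_dvd_sub_le {r : ℤ} (hr : r ≠ 0) (c : ℤ) (N : ℕ) :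
    |(#{x ∈ Icc (-(N : ℤ)) N | r ∣ c + x} : ℝ) - (2 * N / |(r : ℝ)|)| ≤ 2 := by
  have hr' : 0 < |r| := abs_pos.mpr hr
  have hset : {x ∈ Icc (-(N : ℤ)) N | r ∣ c + x} =
      {x ∈ Ico (-(N : ℤ)) (N + 1) | x ≡ -c [ZMOD |r|]} := by
    ext x
    simp only [mem_filter, mem_Icc, mem_Ico, Int.lt_add_one_iff, and_congr_right_iff]
    intro _
    rw [Int.modEq_comm, Int.modEq_iff_dvd, abs_dvd, sub_neg_eq_add, add_comm]
  have hcard := Int.Ico_filter_modEq_card (-(N : ℤ)) (N + 1) hr' (-c)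
  rw [← hset] at hcard
  have hR : (1 : ℚ) ≤ ((|r| : ℤ) : ℚ) := by exact_mod_cast hr'
  have h1 := Int.le_ceil (((N + 1 : ℤ) - (-c : ℤ)) / ((|r| : ℤ) : ℚ))
  have h2 := Int.ceil_lt_add_one (((N + 1 : ℤ) - (-c : ℤ)) / ((|r| : ℤ) : ℚ))
  have h3 := Int.le_ceil (((-N : ℤ) - (-c : ℤ)) / ((|r| : ℤ) : ℚ))
  have h4 := Int.ceil_lt_add_one (((-N : ℤ) - (-c : ℤ)) / ((|r| : ℤ) : ℚ))
  have h5 : (((N + 1 : ℤ) - (-c : ℤ)) / ((|r| : ℤ) : ℚ)) =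
    (((-N : ℤ) - (-c : ℤ)) / ((|r| : ℤ) : ℚ)) + 2 * N / ((|r| : ℤ) : ℚ) + 1 / ((|r| : ℤ) : ℚ) := by
    push_cast; ring
  have h6 : 1 / ((|r| : ℤ) : ℚ) ≤ 1 := by
    rw [div_le_one (by linarith)]; exact hR
  have h6' : 0 < 1 / ((|r| : ℤ) : ℚ) := by positivity
  have h7 : 0 ≤ 2 * N / ((|r| : ℤ) : ℚ) := by positivity
  have hq : |(#{x ∈ Icc (-(N : ℤ)) N | r ∣ c + x} : ℚ) - 2 * N / ((|r| : ℤ) : ℚ)| ≤ 2 := by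
    have hc : (#{x ∈ Icc (-(N : ℤ)) N | r ∣ c + x} : ℚ) =
      max (((⌈((N + 1 : ℤ) - (-c : ℤ)) / ((|r| : ℤ) : ℚ)⌉ : ℤ) : ℚ) -
        ((⌈((-N : ℤ) - (-c : ℤ)) / ((|r| : ℤ) : ℚ)⌉ : ℤ) : ℚ)) 0 := by
      exact_mod_cast hcard
    rw [hc, abs_le]
    constructor
    · have := le_max_left (((⌈((N + 1 : ℤ) - (-c : ℤ)) / ((|r| : ℤ) : ℚ)⌉ : ℤ) : ℚ) -
        ((⌈((-N : ℤ) - (-c : ℤ)) / ((|r| : ℤ) : ℚ)⌉ : ℤ) : ℚ)) 0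
      linarith
    · rw [sub_le_iff_le_add]
      apply max_le <;> linarith
  have := (Rat.cast_le (K := ℝ)).mpr hq
  push_cast at this
  exact_mod_cast this

/-- Vectors in the box whose digit expansion to base `r`, shifted by `c`, is divisible
by `r ^ m`. -/
noncomputable def digitSet (m : ℕ) (r c : ℤ) (N : ℕ) : Finset (Fin m → ℤ) :=
  {x ∈ box m N | r ^ m ∣ c + ∑ i, x i * r ^ (i : ℕ)}

lemma card_digitSet_succ (m : ℕ) {r : ℤ} (hr : r ≠ 0) (c : ℤ) (N : ℕ) :
    #(digitSet (m + 1) r c N) =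
      ∑ y ∈ Icc (-(N : ℤ)) N with r ∣ c + y, #(digitSet m r ((c + y) / r) N) := by
  have key : ∀ x : Fin (m + 1) → ℤ, c + ∑ i, x i * r ^ (i : ℕ) =
      c + x 0 + r * ∑ i : Fin m, x i.succ * r ^ (i : ℕ) := by
    intro x
    rw [Fin.sum_univ_succ, mul_sum]
    simp only [Fin.val_zero, pow_zero, mul_one, Fin.val_succ, pow_succ]
    rw [add_assoc]
    congr 2
    exact sum_congr rfl fun i _ => by ring
  rw [card_eq_sum_card_fiberwise (f := fun x => x 0)
    (t := {y ∈ Icc (-(N : ℤ)) N | r ∣ c + y})]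
  · refine sum_congr rfl fun y hy => ?_
    simp only [mem_filter, mem_Icc] at hy
    obtain ⟨q, hq⟩ := hy.2
    have hq' : (c + y) / r = q := by rw [hq, Int.mul_ediv_cancel_left _ hr]
    refine card_nbij' (fun x => Fin.tail x) (fun x => Fin.cons y x) ?_ ?_ ?_ ?_
    · intro x hx
      simp only [digitSet, coe_filter, mem_filter, mem_box, Set.mem_ofPred_eq, key] at hx ⊢
      refine ⟨fun i => hx.1.1 i.succ, ?_⟩
      have h := hx.1.2
      rw [hx.2, hq, ← mul_add, pow_succ', mul_dvd_mul_iff_left hr] at h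
      rw [hq']
      exact h
    · intro x hx
      simp only [digitSet, coe_filter, mem_filter, mem_box, Set.mem_ofPred_eq, key] at hx ⊢
      refine ⟨⟨fun i => ?_, ?_⟩, by simp⟩
      · refine Fin.cases ?_ (fun i => ?_) i
        · simpa [abs_le] using hy.1
        · simpa using hx.1 i
      · simp only [Fin.cons_zero, Fin.cons_succ]
        rw [hq, ← mul_add, pow_succ', mul_dvd_mul_iff_left hr, ← hq']
        exact hx.2
    · intro x hx
      simp only [coe_filter, Set.mem_ofPred_eq] at hx
      rw [← hx.2]
      exact Fin.cons_self_tail x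
    · intro x _
      simp
  · intro x hx
    simp only [digitSet, coe_filter, mem_box, Set.mem_ofPred_eq, key, mem_Icc] at hx ⊢
    refine ⟨abs_le.mp (hx.1 0), ?_⟩
    have : r ∣ c + x 0 + r * ∑ i : Fin m, x i.succ * r ^ (i : ℕ) :=
      (dvd_pow_self r (Nat.succ_ne_zero m)).trans hx.2
    exact (dvd_add_left (dvd_mul_right _ _)).mp this

lemma card_digitSet_le (m : ℕ) {r : ℤ} (hr : r ≠ 0) (c : ℤ) (N : ℕ) :
    (#(digitSet m r c N) : ℝ) ≤ (2 * N / |(r : ℝ)| + 2) ^ m := by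
  induction m generalizing c with
  | zero =>
    rw [pow_zero]
    exact_mod_cast card_le_one_of_subsingleton _
  | succ m ih =>
    rw [card_digitSet_succ m hr, Nat.cast_sum, pow_succ']
    refine (sum_le_card_nsmul _ _ _ fun y _ => ih _).trans ?_
    rw [nsmul_eq_mul]
    gcongr
    linarith [(abs_le.mp (abs_card_filter_dvd_sub_le hr c N)).2]

lemma le_card_digitSet (m : ℕ) {r : ℤ} (hr : r ≠ 0) (c : ℤ) (N : ℕ)
    (hD : 2 ≤ 2 * N / |(r : ℝ)|) :
    (2 * N / |(r : ℝ)| - 2) ^ m ≤ (#(digitSet m r c N) : ℝ) := by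
  induction m generalizing c with
  | zero =>
    have : digitSet 0 r c N = univ := by
      ext x; simp [digitSet, mem_box, eq_iff_true_of_subsingleton]
    simp [this]
  | succ m ih =>
    rw [card_digitSet_succ m hr, Nat.cast_sum, pow_succ']
    refine le_trans ?_ (card_nsmul_le_sum _ _ _ fun y _ => ih _)
    rw [nsmul_eq_mul]
    have : 0 ≤ 2 * N / |(r : ℝ)| - 2 := by linarith
    gcongr
    linarith [(abs_le.mp (abs_card_filter_dvd_sub_le hr c N)).1]

/-- The monic polynomial of degree `n` with lower coefficients `b`. -/
noncomputable def monicPoly {n : ℕ} (b : Fin n → ℤ) : ℤ[X] := X ^ n + ∑ i, C (b i) * X ^ (i : ℕ)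

lemma eval_monicPoly {n : ℕ} (b : Fin n → ℤ) (r : ℤ) :
    (monicPoly b).eval r = r ^ n + ∑ i, b i * r ^ (i : ℕ) := by
  simp [monicPoly, eval_finsetSum]

/-- Coefficient vectors in the box whose monic polynomial vanishes at `r`. -/
noncomputable def rootSet (n : ℕ) (r : ℤ) (N : ℕ) : Finset (Fin n → ℤ) :=
  {b ∈ box n N | (monicPoly b).eval r = 0}

lemma mem_rootSet_succ {m : ℕ} {r : ℤ} {N : ℕ} {b : Fin (m + 1) → ℤ} :
    b ∈ rootSet (m + 1) r N ↔ (∀ i, |b i| ≤ N) ∧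
      ∑ i : Fin m, b i.castSucc * r ^ (i : ℕ) = -(b (Fin.last m) + r) * r ^ m := by
  rw [rootSet, mem_filter, mem_box, eval_monicPoly, Fin.sum_univ_castSucc]
  simp only [Fin.val_castSucc, Fin.val_last]
  refine and_congr_right fun _ => ⟨fun h => ?_, fun h => ?_⟩
  · linear_combination h
  · linear_combination h

lemma card_rootSet_le {m : ℕ} {r : ℤ} (hr : r ≠ 0) (N : ℕ) :
    #(rootSet (m + 1) r N) ≤ #(digitSet m r 0 N) := by
  refine card_le_card_of_injOn (fun b => Fin.init b) ?_ ?_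
  · intro b hb
    rw [mem_coe, mem_rootSet_succ] at hb
    simp only [digitSet, coe_filter, mem_box, Set.mem_ofPred_eq, zero_add, Fin.init]
    exact ⟨fun i => hb.1 _, by rw [hb.2]; exact dvd_mul_left _ _⟩
  · intro b hb b' hb' h
    rw [mem_coe, mem_rootSet_succ] at hb hb'
    have h' : ∀ i : Fin m, b i.castSucc = b' i.castSucc := fun i => congrFun h i
    have h2 := hb.2
    simp only [h'] at h2
    rw [hb'.2] at h2
    have h3 := mul_right_cancel₀ (pow_ne_zero m hr) h2
    funext i
    refine Fin.lastCases ?_ (fun i => h' i) i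
    linarith

lemma card_digitSet_le_card_rootSet {m : ℕ} (hm : 1 ≤ m) {r : ℤ} {N : ℕ} (hr : 2 ≤ |r|)
    (hN : 2 ^ m * |r| ≤ N) :
    #(digitSet m r 0 N) ≤ #(rootSet (m + 1) r N) := by
  have hr0 : r ≠ 0 := by rintro rfl; simp at hr
  refine card_le_card_of_injOn
    (fun x => Fin.snoc (α := fun _ => ℤ) x (-((∑ i, x i * r ^ (i : ℕ)) / r ^ m) - r)) ?_ ?_
  · intro x hx
    simp only [digitSet, coe_filter, mem_box, Set.mem_ofPred_eq, zero_add] at hx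
    obtain ⟨hx, q, hq⟩ := hx
    rw [mem_coe, mem_rootSet_succ]
    simp only [Fin.snoc_castSucc, Fin.snoc_last]
    rw [hq, Int.mul_ediv_cancel_left _ (pow_ne_zero m hr0)]
    refine ⟨?_, by ring⟩
    have hgeom := geom_sum_mul |r| m
    have hsum : |q| * |r| ^ m ≤ N * ∑ i ∈ range m, |r| ^ i := by
      rw [← abs_pow, mul_comm, ← abs_mul, ← hq, ← Fin.sum_univ_eq_sum_range, mul_sum]
      refine (abs_sum_le_sum_abs _ _).trans (sum_le_sum fun i _ => ?_)
      rw [abs_mul, abs_pow]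
      gcongr
      exact hx i
    have hpow : 0 < |r| ^ m := by positivity
    have hq' : |q| * (|r| - 1) * |r| ^ m ≤ N * (|r| ^ m - 1) := by
      rw [← hgeom]
      nlinarith
    have hmain : |q| + |r| ≤ N := by
      rcases hr.eq_or_lt with h2 | h3
      · rw [← h2] at hq' hN hpow ⊢
        refine le_of_mul_le_mul_right ?_ hpow
        nlinarith
      · have h4 : |q| * (|r| - 1) ≤ N := by
          refine le_of_mul_le_mul_right (hq'.trans ?_) hpow
          nlinarith
        have h5 : 2 * |q| ≤ N := by nlinarith [abs_nonneg q]
        have h6 : (2 : ℤ) ≤ 2 ^ m := by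
          calc (2 : ℤ) = 2 ^ 1 := by norm_num
            _ ≤ 2 ^ m := pow_le_pow_right₀ (by norm_num) hm
        nlinarith
    intro i
    refine Fin.lastCases ?_ (fun i => ?_) i
    · rw [Fin.snoc_last]
      calc |-q - r| = |q + r| := by rw [← abs_neg]; ring_nf
        _ ≤ |q| + |r| := abs_add_le _ _
        _ ≤ N := hmain
    · rw [Fin.snoc_castSucc]
      exact hx i
  · intro x _ y _ h
    exact (Fin.snoc_inj.mp h).1

lemma abs_add_pow_sub_pow_le {D e : ℝ} (m : ℕ) (hD : 2 ≤ D) (he : |e| ≤ 2) :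
    |(D + e) ^ m - D ^ m| ≤ 2 * m * 2 ^ (m - 1) * D ^ (m - 1) := by
  have h := abs_pow_sub_pow_le (D + e) D m
  refine h.trans ?_
  rw [add_sub_cancel_left, mul_assoc (2 * (m : ℝ)), ← mul_pow]
  have : max |D + e| |D| ≤ 2 * D := by
    apply max_le
    · exact (abs_add_le _ _).trans (by rw [abs_of_nonneg (by linarith : 0 ≤ D)]; linarith)
    · rw [abs_of_nonneg (by linarith : 0 ≤ D)]; linarith
  gcongr

lemma exists_abs_card_rootSet_sub_le {m : ℕ} (hm : 1 ≤ m) :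
    ∃ K : ℝ, 0 ≤ K ∧ ∀ (N : ℕ) (r : ℤ), 2 ≤ |r| → |r| ≤ N →
      |(#(rootSet (m + 1) r N) : ℝ) - (2 * N / |(r : ℝ)|) ^ m| ≤ K * (N / |(r : ℝ)|) ^ (m - 1) := by
  refine ⟨(2 * m * 2 ^ (m - 1) + 2 ^ (m + 1)) * 2 ^ (m - 1), by positivity, fun N r hr hrN => ?_⟩
  have hr0 : r ≠ 0 := by rintro rfl; simp at hr
  have hrR : (2 : ℝ) ≤ |(r : ℝ)| := by exact_mod_cast hr
  have hrNR : |(r : ℝ)| ≤ N := by exact_mod_cast hrN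
  rw [mul_assoc, ← mul_pow, ← mul_div_assoc]
  set D : ℝ := 2 * N / |(r : ℝ)| with hDdef
  have hD : 2 ≤ D := by
    rw [hDdef, le_div_iff₀ (by linarith)]
    linarith
  have hup : (#(rootSet (m + 1) r N) : ℝ) ≤ (D + 2) ^ m :=
    (Nat.cast_le.mpr (card_rootSet_le hr0 N)).trans (card_digitSet_le m hr0 0 N)
  have h1 := (abs_le.mp (abs_add_pow_sub_pow_le (e := 2) m hD (by norm_num))).2
  have h2 := (abs_le.mp (abs_add_pow_sub_pow_le (e := -2) m hD (by norm_num))).1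
  have hp : 0 ≤ 2 ^ (m + 1) * D ^ (m - 1) := by positivity
  have hp' : 0 ≤ 2 * m * 2 ^ (m - 1) * D ^ (m - 1) := by positivity
  rw [abs_le, add_mul]
  refine ⟨?_, by linarith⟩
  by_cases hN : 2 ^ m * |r| ≤ N
  · have hlow : (D - 2) ^ m ≤ (#(rootSet (m + 1) r N) : ℝ) :=
      (le_card_digitSet m hr0 0 N hD).trans
        (Nat.cast_le.mpr (card_digitSet_le_card_rootSet hm hr hN))
    rw [← sub_eq_add_neg] at h2
    linarith
  · have hN' : (N : ℝ) ≤ 2 ^ m * |(r : ℝ)| := by exact_mod_cast (not_le.mp hN).le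
    have hD' : D ≤ 2 ^ (m + 1) := by
      rw [hDdef, div_le_iff₀ (by linarith), pow_succ]
      linarith
    have : D ^ m ≤ 2 ^ (m + 1) * D ^ (m - 1) := by
      conv_lhs => rw [← Nat.sub_add_cancel hm, pow_succ']
      gcongr
    have h0 : (0 : ℝ) ≤ #(rootSet (m + 1) r N) := by positivity
    linarith

lemma sum_Icc_neg_eq (f : ℤ → ℝ) (N : ℕ) :
    ∑ r ∈ Icc (-(N : ℤ)) N, f r = f 0 + ∑ j ∈ Ioc 0 N, (f j + f (-j)) := by
  induction N with
  | zero => simp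
  | succ N ih =>
    have h : Icc (-((N + 1 : ℕ) : ℤ)) (N + 1 : ℕ) =
        insert ((N + 1 : ℕ) : ℤ) (insert (-((N + 1 : ℕ) : ℤ)) (Icc (-(N : ℤ)) N)) := by
      ext x
      simp only [mem_Icc, mem_insert]
      omega
    rw [h, sum_insert, sum_insert, ih, sum_Ioc_succ_top (Nat.zero_le N)]
    · ring
    · simp only [mem_Icc]; omega
    · simp only [mem_Icc, mem_insert]; omega

lemma one_le_two_mul_log {N : ℕ} (hN : 2 ≤ N) : 1 ≤ 2 * Real.log N := by
  have h : Real.log 2 ≤ Real.log N := Real.log_le_log (by norm_num) (by exact_mod_cast hN)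
  linarith [Real.log_two_gt_d9]

lemma sum_Ioc_inv_le_one_add_log (N : ℕ) : ∑ j ∈ Ioc 0 N, (j : ℝ)⁻¹ ≤ 1 + Real.log N := by
  have h := harmonic_le_one_add_log N
  rw [harmonic_eq_sum_Icc] at h
  push_cast at h
  exact h

lemma abs_sum_Ioc_sub_zeta_le {m : ℕ} (hm : 2 ≤ m) {N : ℕ} (hN : 1 ≤ N) :
    |∑ j ∈ Ioc 1 N, 1 / (j : ℝ) ^ m - ((riemannZeta m).re - 1)| ≤ 1 / (N : ℝ) ^ (m - 1) := by
  have hz : (riemannZeta m).re = ∑' j : ℕ, 1 / (j : ℝ) ^ m := by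
    rw [zeta_nat_eq_tsum_of_gt_one (by omega)]
    have : (∑' j : ℕ, 1 / (j : ℂ) ^ m) = ((∑' j : ℕ, 1 / (j : ℝ) ^ m : ℝ) : ℂ) := by
      push_cast
      rfl
    rw [this, Complex.ofReal_re]
  have hsplit : ∀ M, N ≤ M → ∑ j ∈ Ioc 0 M, 1 / (j : ℝ) ^ m =
      1 + ∑ j ∈ Ioc 1 N, 1 / (j : ℝ) ^ m + ∑ j ∈ Ioc N M, 1 / (j : ℝ) ^ m := by
    intro M hM
    rw [← sum_Ioc_consecutive _ (Nat.zero_le N) hM, ← sum_Ioc_consecutive _ zero_le_one hN,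
      show Ioc 0 1 = {1} from rfl]
    simp
  have htail : ∀ M, N ≤ M → ∑ j ∈ Ioc N M, 1 / (j : ℝ) ^ m ≤ 1 / (N : ℝ) ^ (m - 1) := by
    intro M hM
    have h1 : ∀ j ∈ Ioc N M, 1 / (j : ℝ) ^ m ≤ 1 / (N : ℝ) ^ (m - 2) * ((j : ℝ) ^ 2)⁻¹ := by
      intro j hj
      rw [mem_Ioc] at hj
      rw [← one_div, one_div_mul_one_div]
      have hNj : (N : ℝ) ≤ j := by exact_mod_cast hj.1.le
      have hN0 : (0 : ℝ) < N := by exact_mod_cast hN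
      have hj0 := hN0.trans_le hNj
      apply one_div_le_one_div_of_le (by positivity)
      calc (N : ℝ) ^ (m - 2) * (j : ℝ) ^ 2 ≤ (j : ℝ) ^ (m - 2) * (j : ℝ) ^ 2 := by gcongr
        _ = (j : ℝ) ^ m := by rw [← pow_add]; congr 1; omega
    refine (sum_le_sum h1).trans ?_
    rw [← mul_sum]
    have h2 := sum_Ioc_inv_sq_le_sub (α := ℝ) (k := N) (n := M) (by omega) hM
    have h3 : ∑ j ∈ Ioc N M, ((j : ℝ) ^ 2)⁻¹ ≤ (N : ℝ)⁻¹ := h2.trans (by simp)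
    calc 1 / (N : ℝ) ^ (m - 2) * ∑ j ∈ Ioc N M, ((j : ℝ) ^ 2)⁻¹
        ≤ 1 / (N : ℝ) ^ (m - 2) * (N : ℝ)⁻¹ := by gcongr
      _ = 1 / (N : ℝ) ^ (m - 1) := by
        rw [← one_div, one_div_mul_one_div, ← pow_succ]; congr 2; omega
  have hlow : 1 + ∑ j ∈ Ioc 1 N, 1 / (j : ℝ) ^ m ≤ (riemannZeta m).re := by
    have h := hsplit N le_rfl
    simp only [Ioc_self, sum_empty, add_zero] at h
    rw [hz, ← h]
    exact (Real.summable_one_div_nat_pow.mpr (by omega)).sum_le_tsum _ fun _ _ => by positivity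
  have hup : (riemannZeta m).re ≤
      1 + ∑ j ∈ Ioc 1 N, 1 / (j : ℝ) ^ m + 1 / (N : ℝ) ^ (m - 1) := by
    rw [hz]
    refine Real.tsum_le_of_sum_range_le (fun _ => by positivity) fun M => ?_
    calc ∑ j ∈ range M, 1 / (j : ℝ) ^ m ≤ ∑ j ∈ insert 0 (Ioc 0 (N + M)), 1 / (j : ℝ) ^ m := by
          refine sum_le_sum_of_subset_of_nonneg (fun j hj => ?_) fun _ _ _ => by positivity
          simp only [mem_insert, mem_Ioc, mem_range] at hj ⊢
          omega
      _ = ∑ j ∈ Ioc 0 (N + M), 1 / (j : ℝ) ^ m := by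
          rw [sum_insert (by simp), Nat.cast_zero, zero_pow (by omega), div_zero, zero_add]
      _ ≤ _ := by
          rw [hsplit _ (Nat.le_add_right N M)]
          gcongr
          exact htail _ (Nat.le_add_right N M)
  rw [abs_le]
  constructor
  · linarith
  · have : 0 ≤ 1 / (N : ℝ) ^ (m - 1) := by positivity
    linarith

lemma exists_abs_sum_card_rootSet_sub_le {m : ℕ} (hm : 2 ≤ m) :
    ∃ K : ℝ, 0 ≤ K ∧ ∀ N : ℕ, 2 ≤ N →
      |∑ j ∈ Ioc 1 N, ((#(rootSet (m + 1) j N) : ℝ) + #(rootSet (m + 1) (-j) N))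
        - 2 ^ (m + 1) * ((riemannZeta m).re - 1) * N ^ m| ≤ K * N ^ (m - 1) * Real.log N := by
  obtain ⟨K, hK, h⟩ := exists_abs_card_rootSet_sub_le (m := m) (by omega)
  refine ⟨6 * K + 2 * 2 ^ (m + 1), by positivity, fun N hN => ?_⟩
  have hN0 : (0 : ℝ) < N := by exact_mod_cast (by omega : 0 < N)
  have hlog := one_le_two_mul_log hN
  have hterm : ∀ j ∈ Ioc 1 N, |(#(rootSet (m + 1) (j : ℤ) N) : ℝ) + #(rootSet (m + 1) (-j) N) -
      2 * (2 * N) ^ m * (1 / (j : ℝ) ^ m)| ≤ 2 * K * N ^ (m - 1) * (j : ℝ)⁻¹ := by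
    intro j hj
    rw [mem_Ioc] at hj
    have hj1 : (1 : ℝ) ≤ j := by exact_mod_cast hj.1.le
    have e1 := h N j (by rw [Nat.abs_cast]; omega) (by rw [Nat.abs_cast]; omega)
    have e2 := h N (-j) (by rw [abs_neg, Nat.abs_cast]; omega) (by rw [abs_neg, Nat.abs_cast]; omega)
    simp only [Int.cast_neg, Int.cast_natCast, abs_neg, Nat.abs_cast, div_pow] at e1 e2
    have hinv : (N : ℝ) ^ (m - 1) / (j : ℝ) ^ (m - 1) ≤ N ^ (m - 1) * (j : ℝ)⁻¹ := by
      rw [div_eq_mul_inv]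
      gcongr
      exact le_self_pow₀ hj1 (by omega)
    have hinv' := mul_le_mul_of_nonneg_left hinv hK
    rw [abs_le] at e1 e2 ⊢
    rw [mul_one_div]
    constructor
    · have : 2 * (2 * (N : ℝ)) ^ m / (j : ℝ) ^ m = 2 * ((2 * N) ^ m / (j : ℝ) ^ m) := by ring
      linarith [e1.1, e2.1]
    · have : 2 * (2 * (N : ℝ)) ^ m / (j : ℝ) ^ m = 2 * ((2 * N) ^ m / (j : ℝ) ^ m) := by ring
      linarith [e1.2, e2.2]
  have hsum : |∑ j ∈ Ioc 1 N, ((#(rootSet (m + 1) j N) : ℝ) + #(rootSet (m + 1) (-j) N))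
      - 2 * (2 * N) ^ m * ∑ j ∈ Ioc 1 N, 1 / (j : ℝ) ^ m| ≤ 6 * K * N ^ (m - 1) * Real.log N := by
    rw [mul_sum, ← sum_sub_distrib]
    refine (abs_sum_le_sum_abs _ _).trans ((sum_le_sum hterm).trans ?_)
    rw [← mul_sum]
    have h1 : ∑ j ∈ Ioc 1 N, (j : ℝ)⁻¹ ≤ 3 * Real.log N := by
      calc ∑ j ∈ Ioc 1 N, (j : ℝ)⁻¹ ≤ ∑ j ∈ Ioc 0 N, (j : ℝ)⁻¹ :=
            sum_le_sum_of_subset_of_nonneg (Ioc_subset_Ioc_left zero_le_one)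
              fun _ _ _ => by positivity
        _ ≤ 1 + Real.log N := sum_Ioc_inv_le_one_add_log N
        _ ≤ 3 * Real.log N := by linarith
    calc 2 * K * N ^ (m - 1) * ∑ j ∈ Ioc 1 N, (j : ℝ)⁻¹
        ≤ 2 * K * N ^ (m - 1) * (3 * Real.log N) := by gcongr
      _ = 6 * K * N ^ (m - 1) * Real.log N := by ring
  have hzeta : |2 * (2 * (N : ℝ)) ^ m * ∑ j ∈ Ioc 1 N, 1 / (j : ℝ) ^ m
      - 2 ^ (m + 1) * ((riemannZeta m).re - 1) * N ^ m| ≤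
        2 * 2 ^ (m + 1) * N ^ (m - 1) * Real.log N := by
    have h1 := abs_sum_Ioc_sub_zeta_le hm (show 1 ≤ N by omega)
    have h2 : 2 * (2 * (N : ℝ)) ^ m * ∑ j ∈ Ioc 1 N, 1 / (j : ℝ) ^ m
      - 2 ^ (m + 1) * ((riemannZeta m).re - 1) * N ^ m = (2 ^ (m + 1) * N ^ m) *
        (∑ j ∈ Ioc 1 N, 1 / (j : ℝ) ^ m - ((riemannZeta m).re - 1)) := by
      rw [mul_pow]; ring
    rw [h2, abs_mul, abs_of_nonneg (by positivity)]
    calc 2 ^ (m + 1) * (N : ℝ) ^ m * |∑ j ∈ Ioc 1 N, 1 / (j : ℝ) ^ m - ((riemannZeta m).re - 1)|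
        ≤ 2 ^ (m + 1) * (N : ℝ) ^ m * (1 / (N : ℝ) ^ (m - 1)) := by gcongr
      _ = 2 ^ (m + 1) * (N : ℝ) ^ 1 * 1 := by
          rw [show (N : ℝ) ^ m = N ^ 1 * N ^ (m - 1) by rw [← pow_add]; congr 1; omega]
          field_simp
      _ ≤ 2 ^ (m + 1) * (N : ℝ) ^ (m - 1) * (2 * Real.log N) := by
          gcongr
          · exact_mod_cast (by omega : 1 ≤ N)
          · omega
      _ = 2 * 2 ^ (m + 1) * N ^ (m - 1) * Real.log N := by ring
  refine (abs_sub_le _ _ _).trans ((add_le_add hsum hzeta).trans (le_of_eq (by ring)))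

lemma card_rootSet_zero (m N : ℕ) : #(rootSet (m + 1) 0 N) = (2 * N + 1) ^ m := by
  rw [← card_box]
  have key : ∀ b : Fin (m + 1) → ℤ, (monicPoly b).eval 0 = b 0 := by
    intro b
    rw [eval_monicPoly, Fin.sum_univ_succ]
    simp
  refine card_nbij' (fun b => Fin.tail b) (fun x => Fin.cons 0 x) ?_ ?_ ?_ ?_
  · intro b hb
    simp only [rootSet, coe_filter, mem_box, Set.mem_ofPred_eq] at hb
    rw [mem_coe, mem_box]
    exact fun i => hb.1 i.succ
  · intro x hx
    rw [mem_coe, mem_box] at hx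
    simp only [rootSet, coe_filter, mem_box, Set.mem_ofPred_eq, key]
    refine ⟨fun i => ?_, by simp⟩
    refine Fin.cases (by simp) (fun i => ?_) i
    simpa using hx i
  · intro b hb
    simp only [rootSet, coe_filter, mem_box, Set.mem_ofPred_eq, key] at hb
    change Fin.cons 0 (Fin.tail b) = b
    rw [← hb.2]
    exact Fin.cons_self_tail b
  · intro x _
    simp

lemma abs_card_rootSet_zero_sub_le (m : ℕ) {N : ℕ} (hN : 1 ≤ N) :
    |(#(rootSet (m + 1) 0 N) : ℝ) - 2 ^ m * N ^ m| ≤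
      2 * m * 2 ^ (m - 1) * 2 ^ (m - 1) * N ^ (m - 1) := by
  have hN' : (1 : ℝ) ≤ N := by exact_mod_cast hN
  have h := abs_add_pow_sub_pow_le (D := 2 * N) (e := 1) m (by linarith) (by norm_num)
  rw [card_rootSet_zero, ← mul_pow, mul_assoc _ (2 ^ (m - 1) : ℝ) ((N : ℝ) ^ _), ← mul_pow]
  exact_mod_cast h

/-- The set of real vectors in the unit cube whose coordinate sum is at most `1` in absolute
value. -/
def slab (m : ℕ) : Set (Fin m → ℝ) := {x | (∀ i, |x i| ≤ 1) ∧ |∑ i, x i| ≤ 1}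

/-- Integer vectors in the box whose coordinate sum, shifted by `e`, is at most `N` in absolute
value. -/
noncomputable def latticeSlab (m : ℕ) (e : ℤ) (N : ℕ) : Finset (Fin m → ℤ) :=
  {x ∈ box m N | |e + ∑ i, x i| ≤ N}

lemma volume_floor_preimage {m : ℕ} (S : Finset (Fin m → ℤ)) :
    MeasureTheory.volume {y : Fin m → ℝ | (fun i => ⌊y i⌋) ∈ S} = #S := by
  have h1 : {y : Fin m → ℝ | (fun i => ⌊y i⌋) ∈ S} =
      ⋃ x ∈ S, Set.univ.pi fun i => Set.Ico ((x i : ℤ) : ℝ) (x i + 1) := by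
    ext y
    simp only [Set.mem_ofPred_eq, Set.mem_iUnion, Set.mem_pi, Set.mem_univ, true_imp_iff,
      Set.mem_Ico, exists_prop]
    constructor
    · intro h
      exact ⟨_, h, fun i => ⟨Int.floor_le _, Int.lt_floor_add_one _⟩⟩
    · rintro ⟨x, hx, hxy⟩
      have : (fun i => ⌊y i⌋) = x := funext fun i => Int.floor_eq_iff.mpr (hxy i)
      rwa [this]
  rw [h1, MeasureTheory.measure_biUnion_finset]
  · simp [Real.volume_pi_Ico]
  · intro x _ x' _ hne
    refine Set.disjoint_left.mpr fun y hy hy' => hne ?_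
    simp only [Set.mem_pi, Set.mem_univ, true_imp_iff, Set.mem_Ico] at hy hy'
    funext i
    rw [← Int.floor_eq_iff.mpr (hy i), ← Int.floor_eq_iff.mpr (hy' i)]
  · exact fun x _ => MeasurableSet.univ_pi fun i => measurableSet_Ico

lemma volume_slab_ne_top (m : ℕ) : MeasureTheory.volume (slab m) ≠ ⊤ := by
  refine ((MeasureTheory.measure_mono ?_).trans_lt
    (isCompact_Icc (a := (-1 : Fin m → ℝ)) (b := 1)).measure_lt_top).ne
  intro x hx
  exact ⟨fun i => (abs_le.mp (hx.1 i)).1, fun i => (abs_le.mp (hx.1 i)).2⟩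

open scoped Pointwise in
lemma toReal_volume_smul_slab (m : ℕ) {t : ℝ} (ht : 0 ≤ t) :
    (MeasureTheory.volume (t • slab m)).toReal =
      t ^ m * (MeasureTheory.volume (slab m)).toReal := by
  rw [MeasureTheory.Measure.addHaar_smul, ENNReal.toReal_mul,
    ENNReal.toReal_ofReal (abs_nonneg _), Module.finrank_fin_fun, abs_of_nonneg (by positivity)]

lemma abs_sum_floor_sub_sum_le {m : ℕ} (y : Fin m → ℝ) :
    |((∑ i, ⌊y i⌋ : ℤ) : ℝ) - ∑ i, y i| ≤ m := by
  push_cast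
  rw [← sum_sub_distrib]
  refine (abs_sum_le_sum_abs _ _).trans ((sum_le_card_nsmul _ _ 1 fun i _ => ?_).trans (by simp))
  rw [abs_le]
  constructor <;> linarith [Int.floor_le (y i), Int.lt_floor_add_one (y i)]

open scoped Pointwise in
lemma card_latticeSlab_le (m : ℕ) {e : ℤ} (he : |e| ≤ 1) (N : ℕ) :
    (#(latticeSlab m e N) : ℝ) ≤
      (N + (m + 1)) ^ m * (MeasureTheory.volume (slab m)).toReal := by
  have ht : (0 : ℝ) < N + (m + 1) := by positivity
  rw [← toReal_volume_smul_slab m ht.le]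
  have hfin : MeasureTheory.volume (((N : ℝ) + (m + 1)) • slab m) ≠ ⊤ := by
    rw [MeasureTheory.Measure.addHaar_smul]
    exact ENNReal.mul_ne_top ENNReal.ofReal_ne_top (volume_slab_ne_top m)
  have h := volume_floor_preimage (latticeSlab m e N)
  rw [← ENNReal.toReal_natCast (#(latticeSlab m e N)), ← h]
  refine ENNReal.toReal_mono hfin (MeasureTheory.measure_mono fun y hy => ?_)
  simp only [latticeSlab, mem_filter, mem_box, Set.mem_ofPred_eq] at hy
  have he' : |(e : ℝ)| ≤ 1 := by exact_mod_cast he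
  have hs : |(e : ℝ) + ((∑ i, ⌊y i⌋ : ℤ) : ℝ)| ≤ N := by exact_mod_cast hy.2
  have hd := abs_sum_floor_sub_sum_le y
  rw [abs_le] at he' hs hd
  rw [Set.mem_smul_set_iff_inv_smul_mem₀ ht.ne']
  constructor
  · intro i
    have h1 : |(⌊y i⌋ : ℝ)| ≤ N := by exact_mod_cast hy.1 i
    rw [abs_le] at h1
    rw [Pi.smul_apply, smul_eq_mul, inv_mul_eq_div, abs_div, abs_of_pos ht, div_le_one ht, abs_le]
    constructor <;> linarith [Int.floor_le (y i), Int.lt_floor_add_one (y i), m.cast_nonneg (α := ℝ)]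
  · simp only [Pi.smul_apply, smul_eq_mul]
    rw [← mul_sum, inv_mul_eq_div, abs_div, abs_of_pos ht, div_le_one ht, abs_le]
    constructor <;> linarith

open scoped Pointwise in
lemma le_card_latticeSlab (m : ℕ) {e : ℤ} (he : |e| ≤ 1) {N : ℕ} (hN : m + 1 ≤ N) :
    (N - (m + 1)) ^ m * (MeasureTheory.volume (slab m)).toReal ≤
      (#(latticeSlab m e N) : ℝ) := by
  have ht : (0 : ℝ) ≤ N - (m + 1) := by
    rw [sub_nonneg]
    exact_mod_cast hN
  rw [← toReal_volume_smul_slab m ht]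
  have h := volume_floor_preimage (latticeSlab m e N)
  rw [← ENNReal.toReal_natCast (#(latticeSlab m e N)), ← h]
  refine ENNReal.toReal_mono (by rw [h]; exact ENNReal.natCast_ne_top _)
    (MeasureTheory.measure_mono ?_)
  rintro _ ⟨x, hx, rfl⟩
  set y : Fin m → ℝ := ((N : ℝ) - (m + 1)) • x with hy
  have he' : |(e : ℝ)| ≤ 1 := by exact_mod_cast he
  have hd := abs_sum_floor_sub_sum_le y
  have hs : |∑ i, y i| ≤ N - (m + 1) := by
    simp only [hy, Pi.smul_apply, smul_eq_mul]
    rw [← mul_sum, abs_mul, abs_of_nonneg ht]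
    exact mul_le_of_le_one_right ht hx.2
  rw [abs_le] at he' hs hd
  change (fun i => ⌊y i⌋) ∈ latticeSlab m e N
  simp only [latticeSlab, mem_filter, mem_box]
  constructor
  · intro i
    have h1 : |y i| ≤ N - (m + 1) := by
      simp only [hy, Pi.smul_apply, smul_eq_mul]
      rw [abs_mul, abs_of_nonneg ht]
      exact mul_le_of_le_one_right ht (hx.1 i)
    rw [abs_le] at h1
    have : |(⌊y i⌋ : ℝ)| ≤ N := by
      rw [abs_le]
      constructor <;>
        linarith [Int.floor_le (y i), Int.lt_floor_add_one (y i), m.cast_nonneg (α := ℝ)]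
    exact_mod_cast this
  · have : |(e : ℝ) + ((∑ i, ⌊y i⌋ : ℤ) : ℝ)| ≤ N := by
      rw [abs_le]
      constructor <;> linarith
    exact_mod_cast this

lemma exists_abs_card_latticeSlab_sub_le {m : ℕ} (hm : 1 ≤ m) :
    ∃ K : ℝ, 0 ≤ K ∧ ∀ (N : ℕ) (e : ℤ), 1 ≤ N → |e| ≤ 1 →
      |(#(latticeSlab m e N) : ℝ) - (MeasureTheory.volume (slab m)).toReal * N ^ m| ≤
        K * N ^ (m - 1) := by
  set k := (MeasureTheory.volume (slab m)).toReal with hk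
  have hk0 : 0 ≤ k := ENNReal.toReal_nonneg
  refine ⟨k * ((m + 1) * m * (m + 2) ^ (m - 1)) + k * (m + 1), by positivity,
    fun N e hN he => ?_⟩
  have hN' : (1 : ℝ) ≤ N := by exact_mod_cast hN
  have hdiff : ∀ s : ℝ, |s| ≤ m + 1 →
      |((N : ℝ) + s) ^ m - N ^ m| ≤ (m + 1) * m * (m + 2) ^ (m - 1) * N ^ (m - 1) := by
    intro s hs
    refine (abs_pow_sub_pow_le _ _ _).trans ?_
    rw [add_sub_cancel_left, mul_assoc _ ((m + 2 : ℝ) ^ (m - 1)), ← mul_pow]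
    have hb : max |(N : ℝ) + s| |(N : ℝ)| ≤ (m + 2) * N := by
      have hm0 : (0 : ℝ) ≤ m := m.cast_nonneg
      apply max_le
      · refine (abs_add_le _ _).trans ?_
        rw [Nat.abs_cast]
        nlinarith
      · rw [Nat.abs_cast]
        nlinarith
    gcongr
  have hm1 : |(m : ℝ) + 1| ≤ m + 1 := (abs_of_nonneg (by positivity)).le
  have hup := card_latticeSlab_le m he N
  have h1 := mul_le_mul_of_nonneg_left (abs_le.mp (hdiff (m + 1) hm1)).2 hk0
  have h2 := mul_le_mul_of_nonneg_left
    (abs_le.mp (hdiff (-(m + 1)) (by rw [abs_neg]; exact hm1))).1 hk0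
  have hp1 : 0 ≤ k * ((m + 1) * m * (m + 2) ^ (m - 1)) * (N : ℝ) ^ (m - 1) := by positivity
  have hp2 : 0 ≤ k * (m + 1) * (N : ℝ) ^ (m - 1) := by positivity
  rw [abs_le, add_mul]
  constructor
  · by_cases hmN : m + 1 ≤ N
    · have hlow := le_card_latticeSlab m he hmN
      rw [← sub_eq_add_neg] at h2
      linarith
    · have h3 : (N : ℝ) ≤ m + 1 := by exact_mod_cast (not_le.mp hmN).le
      have h4 : k * (N : ℝ) ^ m ≤ k * (m + 1) * (N : ℝ) ^ (m - 1) := by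
        rw [mul_assoc]
        gcongr
        conv_lhs => rw [← Nat.sub_add_cancel hm, pow_succ']
        gcongr
      have h5 : (0 : ℝ) ≤ #(latticeSlab m e N) := by positivity
      linarith
  · linarith

lemma card_rootSet_eq_card_latticeSlab (m : ℕ) {r : ℤ} (hr : r * r = 1) (N : ℕ) :
    #(rootSet (m + 1) r N) = #(latticeSlab m (r ^ (m + 1)) N) := by
  have hpow : ∀ i : ℕ, r ^ i * r ^ i = 1 := fun i => by rw [← mul_pow, hr, one_pow]
  have habs : ∀ i : ℕ, |r ^ i| = 1 := fun i => by
    rcases mul_self_eq_one_iff.mp (hpow i) with h | h <;> rw [h] <;> rfl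
  refine card_nbij' (fun b i => b (Fin.castSucc i) * r ^ (i : ℕ))
    (fun x => Fin.snoc (α := fun _ => ℤ) (fun i => x i * r ^ (i : ℕ))
      (-(r ^ (m + 1) + ∑ i, x i) * r ^ m)) ?_ ?_ ?_ ?_
  · intro b hb
    rw [mem_coe, mem_rootSet_succ] at hb
    simp only [latticeSlab, coe_filter, mem_box, Set.mem_ofPred_eq]
    refine ⟨fun i => ?_, ?_⟩
    · rw [abs_mul, habs, mul_one]
      exact hb.1 _
    · rw [hb.2, show r ^ (m + 1) + -(b (Fin.last m) + r) * r ^ m = -b (Fin.last m) * r ^ m by ring,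
        abs_mul, habs, mul_one, abs_neg]
      exact hb.1 _
  · intro x hx
    simp only [latticeSlab, coe_filter, mem_box, Set.mem_ofPred_eq] at hx
    rw [mem_coe, mem_rootSet_succ]
    simp only [Fin.snoc_castSucc, Fin.snoc_last, mul_assoc, hpow, mul_one]
    refine ⟨fun i => ?_, ?_⟩
    · refine Fin.lastCases ?_ (fun i => ?_) i
      · rw [Fin.snoc_last, abs_mul, habs, mul_one, abs_neg]
        exact hx.2
      · rw [Fin.snoc_castSucc, abs_mul, habs, mul_one]
        exact hx.1 i
    · linear_combination -(r ^ (m + 1) + ∑ i, x i) * hpow m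
  · intro b hb
    rw [mem_coe, mem_rootSet_succ] at hb
    funext i
    refine Fin.lastCases ?_ (fun i => ?_) i
    · simp only [Fin.snoc_last]
      rw [hb.2]
      linear_combination b (Fin.last m) * hpow m
    · simp only [Fin.snoc_castSucc, mul_assoc, hpow, mul_one]
  · intro x _
    funext i
    simp only [Fin.snoc_castSucc, mul_assoc, hpow, mul_one]

lemma sum_box_prod_inv_le (k B : ℕ) :
    ∑ v ∈ box k B, ∏ i, ((max 1 (v i).natAbs : ℕ) : ℝ)⁻¹ ≤ (3 + 2 * Real.log B) ^ k := by
  rw [box, ← prod_univ_sum (t := fun _ => Icc (-(B : ℤ)) B)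
    (f := fun _ j => ((max 1 j.natAbs : ℕ) : ℝ)⁻¹), prod_const, card_univ, Fintype.card_fin]
  have hsum : ∑ j ∈ Icc (-(B : ℤ)) B, ((max 1 j.natAbs : ℕ) : ℝ)⁻¹ =
      1 + 2 * ∑ j ∈ Ioc 0 B, (j : ℝ)⁻¹ := by
    rw [sum_Icc_neg_eq, mul_sum]
    congr 1
    · simp
    · refine sum_congr rfl fun j hj => ?_
      rw [mem_Ioc] at hj
      rw [Int.natAbs_neg, Int.natAbs_natCast, max_eq_right hj.1]
      ring
  have h := sum_Ioc_inv_le_one_add_log B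
  refine pow_le_pow_left₀ (sum_nonneg fun _ _ => by positivity) ?_ k
  rw [hsum]
  linarith

lemma card_le_of_weight {β : Type*} {k l B : ℕ} (S : Finset β) (f : β → Fin k → ℤ)
    (g : β → Fin l → ℤ) (W : (Fin k → ℤ) → ℕ)
    (hinj : ∀ b ∈ S, ∀ b' ∈ S, f b = f b' → g b = g b' → b = b')
    (hW : ∀ v, 1 ≤ W v) (hWv : ∀ v i, (v i).natAbs ≤ W v)
    (hWl : ∀ v, ∏ i, max 1 (v i).natAbs ≤ W v ^ l)
    (hf : ∀ b ∈ S, W (f b) ≤ B) (hg : ∀ b ∈ S, ∀ j, (g b j).natAbs * W (f b) ≤ B) :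
    (#S : ℝ) ≤ (3 * B) ^ l * (3 + 2 * Real.log B) ^ k := by
  classical
  have hmaps : ∀ b ∈ S, f b ∈ box k B := by
    intro b hb
    rw [mem_box]
    intro i
    rw [Int.abs_eq_natAbs]
    exact_mod_cast (hWv (f b) i).trans (hf b hb)
  have hfib : ∀ v ∈ box k B, (#{b ∈ S | f b = v} : ℝ) ≤
      (3 * B) ^ l * ∏ i, ((max 1 (v i).natAbs : ℕ) : ℝ)⁻¹ := by
    intro v _
    rcases ({b ∈ S | f b = v} : Finset β).eq_empty_or_nonempty with h0 | ⟨b₀, hb₀⟩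
    · rw [h0, card_empty, Nat.cast_zero]
      positivity
    · rw [mem_filter] at hb₀
      have hWB : W v ≤ B := hb₀.2 ▸ hf b₀ hb₀.1
      have hcard : #{b ∈ S | f b = v} ≤ (2 * (B / W v) + 1) ^ l := by
        rw [← card_box]
        refine card_le_card_of_injOn g ?_ ?_
        · intro b hb
          rw [mem_coe, mem_filter] at hb
          rw [mem_coe, mem_box]
          intro j
          have := hg b hb.1 j
          rw [hb.2, ← Nat.le_div_iff_mul_le (hW v)] at this
          rw [Int.abs_eq_natAbs]
          exact_mod_cast this
        · intro b hb b' hb' h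
          rw [mem_coe, mem_filter] at hb hb'
          exact hinj b hb.1 b' hb'.1 (hb.2.trans hb'.2.symm) h
      have hWpos : (0 : ℝ) < W v := by exact_mod_cast hW v
      have hBW : (1 : ℝ) ≤ B / W v := by
        rw [one_le_div hWpos]
        exact_mod_cast hWB
      have hprod : ((W v : ℝ) ^ l)⁻¹ ≤ ∏ i, ((max 1 (v i).natAbs : ℕ) : ℝ)⁻¹ := by
        rw [prod_inv_distrib]
        refine inv_anti₀ (prod_pos fun i _ => ?_) ?_
        · exact_mod_cast (le_max_left 1 _ : 1 ≤ max 1 (v i).natAbs)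
        · exact_mod_cast hWl v
      calc (#{b ∈ S | f b = v} : ℝ) ≤ (2 * ((B / W v : ℕ) : ℝ) + 1) ^ l := by exact_mod_cast hcard
        _ ≤ (3 * (B / W v)) ^ l := by
          have : ((B / W v : ℕ) : ℝ) ≤ B / W v := Nat.cast_div_le
          gcongr
          linarith
        _ = (3 * B) ^ l * ((W v : ℝ) ^ l)⁻¹ := by rw [← mul_div_assoc, div_pow, div_eq_mul_inv]
        _ ≤ _ := by gcongr
  rw [card_eq_sum_card_fiberwise (f := f) (t := box k B) hmaps, Nat.cast_sum]
  refine (sum_le_sum hfib).trans ?_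
  rw [← mul_sum]
  gcongr
  exact sum_box_prod_inv_le k B

lemma exists_pow_mul_log_pow_le {k l A : ℕ} (hk : 2 ≤ k) (hA : 1 ≤ A) :
    ∃ K : ℝ, 0 ≤ K ∧ ∀ N : ℕ, 2 ≤ N →
      (3 * (A * N : ℕ) : ℝ) ^ l * (3 + 2 * Real.log (A * N : ℕ)) ^ k ≤
        K * N ^ (k + l - 2) * Real.log N ^ 2 := by
  have hA' : (1 : ℝ) ≤ A := by exact_mod_cast hA
  have hlogA := Real.log_nonneg hA'
  refine ⟨(3 * A) ^ l * (2 * (3 + 2 * Real.log A) + 2) ^ k, by positivity, fun N hN => ?_⟩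
  have hN' : (1 : ℝ) ≤ N := by exact_mod_cast (by omega : 1 ≤ N)
  have hlog := one_le_two_mul_log hN
  have hlog0 : 0 ≤ Real.log N := Real.log_nonneg hN'
  have hlogN : Real.log N ≤ N := Real.log_le_self (by linarith)
  push_cast
  rw [Real.log_mul (by positivity) (by positivity)]
  calc (3 * ((A : ℝ) * N)) ^ l * (3 + 2 * (Real.log A + Real.log N)) ^ k
      ≤ (3 * ((A : ℝ) * N)) ^ l * ((2 * (3 + 2 * Real.log A) + 2) * Real.log N) ^ k := by
        gcongr
        nlinarith
    _ = (3 * A) ^ l * (2 * (3 + 2 * Real.log A) + 2) ^ k *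
          (N ^ l * (Real.log N ^ (k - 2) * Real.log N ^ 2)) := by
        rw [← pow_add, Nat.sub_add_cancel hk]
        simp only [mul_pow]
        ring
    _ ≤ (3 * A) ^ l * (2 * (3 + 2 * Real.log A) + 2) ^ k *
          (N ^ l * ((N : ℝ) ^ (k - 2) * Real.log N ^ 2)) := by gcongr
    _ = _ := by
        rw [show k + l - 2 = l + (k - 2) by omega, pow_add]
        ring

lemma monicPoly_eq_sum_range {n : ℕ} {p : ℤ[X]} (hp : p.Monic) (hn : p.natDegree = n) :
    monicPoly (fun i : Fin n => p.coeff i) = p := by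
  subst hn
  conv_rhs => rw [hp.as_sum]
  rw [monicPoly, Fin.sum_univ_eq_sum_range (fun i => C (p.coeff i) * X ^ i)]

lemma degree_sum_lt {n : ℕ} (b : Fin n → ℤ) :
    (∑ i, C (b i) * X ^ (i : ℕ) : ℤ[X]).degree < n := by
  refine (degree_sum_le _ _).trans_lt ((Finset.sup_lt_iff (WithBot.bot_lt_coe n)).mpr fun i _ => ?_)
  exact (degree_C_mul_X_pow_le _ _).trans_lt (Nat.cast_lt.mpr i.2)

lemma monic_monicPoly {n : ℕ} (b : Fin n → ℤ) : (monicPoly b).Monic :=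
  monic_X_pow_add (degree_sum_lt b)

lemma natDegree_monicPoly {n : ℕ} (b : Fin n → ℤ) : (monicPoly b).natDegree = n := by
  rw [monicPoly, add_comm]
  exact natDegree_eq_of_degree_eq_some (by
    rw [degree_add_eq_right_of_degree_lt] <;> rw [degree_X_pow]
    exact degree_sum_lt b)

lemma coeff_monicPoly {n : ℕ} (b : Fin n → ℤ) (i : Fin n) : (monicPoly b).coeff i = b i := by
  rw [monicPoly, coeff_add, coeff_X_pow, if_neg i.2.ne, zero_add, finsetSum_coeff]
  simp [coeff_X_pow, Fin.val_inj]

lemma monicPoly_injective (n : ℕ) :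
    Function.Injective (monicPoly : (Fin n → ℤ) → ℤ[X]) := fun b b' h => by
  funext i
  rw [← coeff_monicPoly b i, h, coeff_monicPoly]

/-- The Mahler measure of an integer polynomial. -/
noncomputable def mahler (p : ℤ[X]) : ℝ := (p.map (Int.castRingHom ℂ)).mahlerMeasure

lemma mahler_nonneg (p : ℤ[X]) : 0 ≤ mahler p := mahlerMeasure_nonneg _

lemma mahler_mul (p q : ℤ[X]) : mahler (p * q) = mahler p * mahler q := by
  rw [mahler, Polynomial.map_mul, mahlerMeasure_mul, mahler, mahler]

lemma mahler_X_sub_C (r : ℤ) : mahler (X - C r) = (max 1 r.natAbs : ℕ) := by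
  rw [mahler, Polynomial.map_sub, map_X, map_C, mahlerMeasure_X_sub_C]
  push_cast
  rw [eq_intCast, Complex.norm_intCast, Nat.cast_natAbs, Int.cast_abs]

lemma natAbs_coeff_le {p : ℤ[X]} {n : ℕ} (hn : p.natDegree ≤ n) (i : ℕ) :
    ((p.coeff i).natAbs : ℝ) ≤ 2 ^ n * mahler p := by
  have h := norm_coeff_le_choose_mul_mahlerMeasure i (p.map (Int.castRingHom ℂ))
  rw [coeff_map, eq_intCast, Complex.norm_intCast] at h
  rw [Nat.cast_natAbs, Int.cast_abs]
  refine h.trans ?_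
  have h0 := mahler_nonneg p
  rw [← mahler]
  gcongr
  have h1 := (Nat.choose_le_two_pow (p.map (Int.castRingHom ℂ)).natDegree i).trans
    (pow_le_pow_right₀ one_le_two (natDegree_map_le.trans hn))
  exact_mod_cast h1

lemma mahler_monicPoly_le {n N : ℕ} (hN : 1 ≤ N) {b : Fin n → ℤ} (hb : b ∈ box n N) :
    mahler (monicPoly b) ≤ (n + 1) * N := by
  refine (mahlerMeasure_le_sum_norm_coeff _).trans ?_
  rw [Polynomial.sum_def]
  refine (sum_le_card_nsmul _ _ (N : ℝ) fun i _ => ?_).trans ?_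
  · rw [coeff_map, eq_intCast, Complex.norm_intCast]
    rcases lt_trichotomy i n with h | h | h
    · rw [coeff_monicPoly b ⟨i, h⟩]
      exact_mod_cast mem_box.mp hb _
    · have := (monic_monicPoly b).coeff_natDegree
      rw [natDegree_monicPoly] at this
      rw [h, this]
      simpa using hN
    · rw [coeff_eq_zero_of_natDegree_lt (by rwa [natDegree_monicPoly])]
      simp
  · rw [nsmul_eq_mul]
    gcongr
    have h := card_supp_le_succ_natDegree ((monicPoly b).map (Int.castRingHom ℂ))
    rw [(monic_monicPoly b).natDegree_map, natDegree_monicPoly] at h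
    exact_mod_cast h

lemma natAbs_coeff_mul_natAbs_coeff_le {n N : ℕ} (hN : 1 ≤ N) {b : Fin n → ℤ} (hb : b ∈ box n N)
    {p q : ℤ[X]} (hp : p.Monic) (hq : q.Monic) (hpq : p * q = monicPoly b) (i j : ℕ) :
    (p.coeff i).natAbs * (q.coeff j).natAbs ≤ 4 ^ n * (n + 1) * N := by
  have hdeg : p.natDegree + q.natDegree = n := by
    rw [← hp.natDegree_mul hq, hpq, natDegree_monicPoly]
  have h1 := natAbs_coeff_le (p := p) (n := n) (by omega) i
  have h2 := natAbs_coeff_le (p := q) (n := n) (by omega) j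
  have h3 := mahler_monicPoly_le hN hb
  rw [← hpq, mahler_mul] at h3
  have hp0 := mahler_nonneg p
  have : ((p.coeff i).natAbs : ℝ) * (q.coeff j).natAbs ≤ 4 ^ n * (n + 1) * N := by
    calc ((p.coeff i).natAbs : ℝ) * (q.coeff j).natAbs
        ≤ (2 ^ n * mahler p) * (2 ^ n * mahler q) := by gcongr
      _ = 4 ^ n * (mahler p * mahler q) := by
        rw [show (4 : ℝ) = 2 * 2 by norm_num, mul_pow]; ring
      _ ≤ 4 ^ n * ((n + 1) * N) := by gcongr
      _ = _ := by ring
  exact_mod_cast this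

lemma natAbs_root_mul_natAbs_root_mul_le {n N : ℕ} (hN : 1 ≤ N) {b : Fin n → ℤ}
    (hb : b ∈ box n N) {r s : ℤ} {q : ℤ[X]} (hq : q.Monic)
    (hpq : (X - C r) * ((X - C s) * q) = monicPoly b) (j : ℕ) :
    (q.coeff j).natAbs * (max 1 r.natAbs * max 1 s.natAbs) ≤ 4 ^ n * (n + 1) * N := by
  have hdeg : 1 + (1 + q.natDegree) = n := by
    rw [← natDegree_monicPoly b, ← hpq, (monic_X_sub_C r).natDegree_mul ((monic_X_sub_C s).mul hq),
      (monic_X_sub_C s).natDegree_mul hq, natDegree_X_sub_C, natDegree_X_sub_C]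
  have h2 := natAbs_coeff_le (p := q) (n := n) (by omega) j
  have h3 := mahler_monicPoly_le hN hb
  have hq0 := mahler_nonneg q
  rw [← hpq, mahler_mul, mahler_mul, mahler_X_sub_C, mahler_X_sub_C] at h3
  have : ((q.coeff j).natAbs : ℝ) * (((max 1 r.natAbs : ℕ) : ℝ) * ((max 1 s.natAbs : ℕ) : ℝ)) ≤
      4 ^ n * (n + 1) * N := by
    calc ((q.coeff j).natAbs : ℝ) * (((max 1 r.natAbs : ℕ) : ℝ) * ((max 1 s.natAbs : ℕ) : ℝ))
        ≤ (2 ^ n * mahler q) * (((max 1 r.natAbs : ℕ) : ℝ) * ((max 1 s.natAbs : ℕ) : ℝ)) := by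
          gcongr
      _ = 2 ^ n * (((max 1 r.natAbs : ℕ) : ℝ) * (((max 1 s.natAbs : ℕ) : ℝ) * mahler q)) := by ring
      _ ≤ 4 ^ n * ((n + 1) * N) := by
        gcongr
        norm_num
      _ = _ := by ring
  exact_mod_cast this

/-- Coefficient vectors in the box whose monic polynomial has a monic factor of degree `k`. -/
noncomputable def factorSet (n k N : ℕ) : Finset (Fin n → ℤ) := by
  classical
  exact {b ∈ box n N | ∃ p q : ℤ[X], p.Monic ∧ q.Monic ∧ p.natDegree = k ∧ p * q = monicPoly b}

/-- Coefficient vectors in the box whose monic polynomial has two distinct integer roots. -/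
noncomputable def twoRootSet (n N : ℕ) : Finset (Fin n → ℤ) := by
  classical
  exact {b ∈ box n N | ∃ r s : ℤ, r ≠ s ∧ (monicPoly b).eval r = 0 ∧ (monicPoly b).eval s = 0}

lemma exists_card_factorSet_le {n k : ℕ} (hk : 2 ≤ k) (hkn : 2 * k ≤ n) :
    ∃ K : ℝ, 0 ≤ K ∧ ∀ N : ℕ, 2 ≤ N →
      (#(factorSet n k N) : ℝ) ≤ K * N ^ (n - 2) * Real.log N ^ 2 := by
  classical
  obtain ⟨K, hK, h⟩ := exists_pow_mul_log_pow_le (k := k) (l := n - k) (A := 4 ^ n * (n + 1)) hk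
    (Nat.one_le_iff_ne_zero.mpr (by positivity))
  refine ⟨K, hK, fun N hN => ?_⟩
  have h' := h N hN
  rw [show k + (n - k) - 2 = n - 2 by omega] at h'
  refine le_trans ?_ h'
  have hex : ∀ b : Fin n → ℤ, ∃ pq : ℤ[X] × ℤ[X], b ∈ factorSet n k N →
      pq.1.Monic ∧ pq.2.Monic ∧ pq.1.natDegree = k ∧ pq.1 * pq.2 = monicPoly b := by
    intro b
    by_cases hb : b ∈ factorSet n k N
    · have hb' := hb
      simp only [factorSet, mem_filter] at hb'
      obtain ⟨_, p, q, hpq⟩ := hb'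
      exact ⟨(p, q), fun _ => hpq⟩
    · exact ⟨0, fun h => absurd h hb⟩
  choose pq hpq using hex
  have hdeg : ∀ b ∈ factorSet n k N, (pq b).2.natDegree = n - k := by
    intro b hb
    obtain ⟨h1, h2, h3, h4⟩ := hpq b hb
    have := h1.natDegree_mul h2
    rw [h4, natDegree_monicPoly] at this
    omega
  have hbox : ∀ b ∈ factorSet n k N, b ∈ box n N := fun b hb => by
    simp only [factorSet, mem_filter] at hb
    exact hb.1
  have hbound : ∀ b ∈ factorSet n k N, ∀ j, ((pq b).2.coeff j).natAbs *
      max 1 (univ.sup fun i : Fin k => ((pq b).1.coeff i).natAbs) ≤ 4 ^ n * (n + 1) * N := by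
    intro b hb j
    obtain ⟨h1, h2, h3, h4⟩ := hpq b hb
    have hmul := natAbs_coeff_mul_natAbs_coeff_le (by omega) (hbox b hb) h1 h2 h4
    rw [mul_comm]
    rcases max_choice 1 (univ.sup fun i : Fin k => ((pq b).1.coeff i).natAbs) with hm | hm <;> rw [hm]
    · have := hmul k j
      rw [← h3, h1.coeff_natDegree] at this
      simpa using this
    · have : Nonempty (Fin k) := ⟨⟨0, by omega⟩⟩
      obtain ⟨i, -, hi⟩ := exists_mem_eq_sup (univ : Finset (Fin k)) univ_nonempty
        (fun i : Fin k => ((pq b).1.coeff i).natAbs)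
      rw [hi]
      exact hmul i j
  refine card_le_of_weight (factorSet n k N) (fun b i => (pq b).1.coeff i)
    (fun b j => (pq b).2.coeff j) (fun v => max 1 (univ.sup fun i => (v i).natAbs)) ?_ ?_ ?_ ?_ ?_ ?_
  · intro b hb b' hb' hf hg
    obtain ⟨h1, h2, h3, h4⟩ := hpq b hb
    obtain ⟨h1', h2', h3', h4'⟩ := hpq b' hb'
    apply monicPoly_injective
    rw [← h4, ← h4', ← monicPoly_eq_sum_range h1 h3, ← monicPoly_eq_sum_range h1' h3',
      ← monicPoly_eq_sum_range h2 (hdeg b hb), ← monicPoly_eq_sum_range h2' (hdeg b' hb'), hf, hg]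
  · exact fun v => le_max_left _ _
  · exact fun v i => (le_sup (f := fun i => (v i).natAbs) (mem_univ i)).trans (le_max_right _ _)
  · intro v
    refine (prod_le_pow_card univ _ _ fun i _ => max_le_max le_rfl
      (le_sup (f := fun i => (v i).natAbs) (mem_univ i))).trans ?_
    rw [card_univ, Fintype.card_fin]
    exact pow_le_pow_right₀ (le_max_left _ _) (by omega)
  · intro b hb
    obtain ⟨h1, h2, h3, h4⟩ := hpq b hb
    have := hbound b hb (n - k)
    rw [← hdeg b hb, h2.coeff_natDegree] at this
    simpa using this
  · exact fun b hb j => hbound b hb j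

lemma exists_card_twoRootSet_le {n : ℕ} (hn : 3 ≤ n) :
    ∃ K : ℝ, 0 ≤ K ∧ ∀ N : ℕ, 2 ≤ N →
      (#(twoRootSet n N) : ℝ) ≤ K * N ^ (n - 2) * Real.log N ^ 2 := by
  classical
  obtain ⟨K, hK, h⟩ := exists_pow_mul_log_pow_le (k := 2) (l := n - 2) (A := 4 ^ n * (n + 1)) le_rfl
    (Nat.one_le_iff_ne_zero.mpr (by positivity))
  refine ⟨K, hK, fun N hN => ?_⟩
  have h' := h N hN
  rw [show 2 + (n - 2) - 2 = n - 2 by omega] at h'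
  refine le_trans ?_ h'
  have hex : ∀ b : Fin n → ℤ, ∃ t : ℤ × ℤ × ℤ[X], b ∈ twoRootSet n N →
      t.2.2.Monic ∧ (X - C t.1) * ((X - C t.2.1) * t.2.2) = monicPoly b := by
    intro b
    by_cases hb : b ∈ twoRootSet n N
    · have hb' := hb
      simp only [twoRootSet, mem_filter] at hb'
      obtain ⟨_, r, s, hrs, hr, hs⟩ := hb'
      obtain ⟨p, hp⟩ := dvd_iff_isRoot.mpr hr
      have hs' : p.eval s = 0 := by
        rw [hp, eval_mul] at hs
        refine (mul_eq_zero.mp hs).resolve_left ?_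
        simpa [sub_eq_zero] using hrs.symm
      obtain ⟨q, hq⟩ := dvd_iff_isRoot.mpr hs'
      have hm := monic_monicPoly b
      rw [hp] at hm
      have hpm := (monic_X_sub_C r).of_mul_monic_left hm
      rw [hq] at hpm
      exact ⟨(r, s, q), fun _ => ⟨(monic_X_sub_C s).of_mul_monic_left hpm, by rw [hp, hq]⟩⟩
    · exact ⟨(0, 0, 0), fun h => absurd h hb⟩
  choose t ht using hex
  have hdeg : ∀ b ∈ twoRootSet n N, (t b).2.2.natDegree = n - 2 := by
    intro b hb
    obtain ⟨h1, h2⟩ := ht b hb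
    have h3 := natDegree_monicPoly b
    rw [← h2, (monic_X_sub_C _).natDegree_mul ((monic_X_sub_C _).mul h1),
      (monic_X_sub_C _).natDegree_mul h1, natDegree_X_sub_C, natDegree_X_sub_C] at h3
    omega
  have hbound : ∀ b ∈ twoRootSet n N, ∀ j, ((t b).2.2.coeff j).natAbs *
      (max 1 (t b).1.natAbs * max 1 (t b).2.1.natAbs) ≤ 4 ^ n * (n + 1) * N := by
    intro b hb j
    obtain ⟨h1, h2⟩ := ht b hb
    simp only [twoRootSet, mem_filter] at hb
    exact natAbs_root_mul_natAbs_root_mul_le (by omega) hb.1 h1 h2 j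
  refine card_le_of_weight (twoRootSet n N) (fun b => ![(t b).1, (t b).2.1])
    (fun b j => (t b).2.2.coeff j) (fun v => max 1 (v 0).natAbs * max 1 (v 1).natAbs)
    ?_ ?_ ?_ ?_ ?_ ?_
  · intro b hb b' hb' hf hg
    obtain ⟨h1, h2⟩ := ht b hb
    obtain ⟨h1', h2'⟩ := ht b' hb'
    apply monicPoly_injective
    have e0 := congrFun hf 0
    have e1 := congrFun hf 1
    simp only [Matrix.cons_val_zero, Matrix.cons_val_one] at e0 e1
    rw [← h2, ← h2', ← monicPoly_eq_sum_range h1 (hdeg b hb),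
      ← monicPoly_eq_sum_range h1' (hdeg b' hb'), hg, e0, e1]
  · exact fun v => Nat.mul_pos (le_max_left 1 _) (le_max_left 1 _)
  · intro v i
    have h0 : 1 ≤ max 1 (v 0).natAbs := le_max_left _ _
    have h1 : 1 ≤ max 1 (v 1).natAbs := le_max_left _ _
    fin_cases i
    · exact (le_max_right 1 _).trans (Nat.le_mul_of_pos_right _ h1)
    · exact (le_max_right 1 _).trans (Nat.le_mul_of_pos_left _ h0)
  · intro v
    rw [Fin.prod_univ_two]
    exact le_self_pow₀ (Nat.mul_pos (le_max_left 1 _) (le_max_left 1 _)) (by omega)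
  · intro b hb
    obtain ⟨h1, h2⟩ := ht b hb
    have := hbound b hb (n - 2)
    rw [← hdeg b hb, h1.coeff_natDegree] at this
    simpa using this
  · exact fun b hb j => hbound b hb j

lemma abs_le_of_eval_monicPoly_eq_zero {n N : ℕ} {b : Fin n → ℤ} (hb : b ∈ box n N) {r : ℤ}
    (hr : (monicPoly b).eval r = 0) : |r| ≤ N := by
  rw [eval_monicPoly, add_eq_zero_iff_eq_neg] at hr
  by_contra! h
  have h1 : |r| ^ n ≤ (|r| - 1) * ∑ i ∈ range n, |r| ^ i := by
    rw [← abs_pow, hr, abs_neg, mul_sum, ← Fin.sum_univ_eq_sum_range (fun i => (|r| - 1) * |r| ^ i)]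
    refine (abs_sum_le_sum_abs _ _).trans (sum_le_sum fun i _ => ?_)
    rw [abs_mul, abs_pow]
    have := mem_box.mp hb i
    gcongr
    omega
  rw [mul_comm, geom_sum_mul] at h1
  omega

/-- Coefficient vectors in the box whose monic polynomial is reducible. -/
noncomputable def reducibleSet (n N : ℕ) : Finset (Fin n → ℤ) := by
  classical
  exact {b ∈ box n N | ¬ Irreducible (monicPoly b)}

lemma not_irreducible_of_eval_eq_zero {n : ℕ} (hn : 2 ≤ n) {b : Fin n → ℤ} {r : ℤ}
    (hr : (monicPoly b).eval r = 0) : ¬ Irreducible (monicPoly b) := by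
  have h1 : monicPoly b ≠ 1 := fun h => by
    have := natDegree_monicPoly b
    rw [h, natDegree_one] at this
    omega
  rw [(monic_monicPoly b).irreducible_iff_lt_natDegree_lt h1]
  intro h
  refine h (X - C r) (monic_X_sub_C r) ?_ (dvd_iff_isRoot.mpr hr)
  rw [natDegree_X_sub_C, natDegree_monicPoly, mem_Ioc]
  omega

lemma exists_factor_of_not_irreducible {n : ℕ} (hn : 1 ≤ n) {b : Fin n → ℤ}
    (hb : ¬ Irreducible (monicPoly b)) :
    (∃ r, (monicPoly b).eval r = 0) ∨ ∃ k ∈ Icc 2 (n / 2), ∃ p q : ℤ[X],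
      p.Monic ∧ q.Monic ∧ p.natDegree = k ∧ p * q = monicPoly b := by
  have h1 : monicPoly b ≠ 1 := fun h => by
    have := natDegree_monicPoly b
    rw [h, natDegree_one] at this
    omega
  rw [(monic_monicPoly b).irreducible_iff_lt_natDegree_lt h1, natDegree_monicPoly] at hb
  push Not at hb
  obtain ⟨p, hp, hdeg, q, hq⟩ := hb
  rw [mem_Ioc] at hdeg
  rcases Nat.eq_or_lt_of_le hdeg.1 with h | h
  · left
    refine ⟨-p.coeff 0, ?_⟩
    rw [hq, hp.eq_X_add_C (by omega)]
    simp
  · right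
    have hm := monic_monicPoly b
    rw [hq] at hm
    exact ⟨p.natDegree, mem_Icc.mpr ⟨h, hdeg.2⟩, p, q, hp, hp.of_mul_monic_left hm, rfl, hq.symm⟩

lemma card_reducibleSet_le {n : ℕ} (hn : 1 ≤ n) (N : ℕ) :
    #(reducibleSet n N) ≤ ∑ r ∈ Icc (-(N : ℤ)) N, #(rootSet n r N) +
      ∑ k ∈ Icc 2 (n / 2), #(factorSet n k N) := by
  classical
  refine (card_le_card (t := (Icc (-(N : ℤ)) N).biUnion (rootSet n · N) ∪
    (Icc 2 (n / 2)).biUnion (factorSet n · N)) ?_).trans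
    ((card_union_le _ _).trans (add_le_add card_biUnion_le card_biUnion_le))
  intro b hb
  simp only [reducibleSet, mem_filter] at hb
  simp only [mem_union, mem_biUnion, rootSet, factorSet, mem_filter]
  rcases exists_factor_of_not_irreducible hn hb.2 with ⟨r, hr⟩ | ⟨k, hk, h⟩
  · exact Or.inl ⟨r, mem_Icc.mpr (abs_le.mp (abs_le_of_eval_monicPoly_eq_zero hb.1 hr)), hb.1, hr⟩
  · exact Or.inr ⟨k, hk, hb.1, h⟩

lemma sum_card_rootSet_le {n : ℕ} (hn : 2 ≤ n) (N : ℕ) :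
    ∑ r ∈ Icc (-(N : ℤ)) N, #(rootSet n r N) ≤ #(reducibleSet n N) + n * #(twoRootSet n N) := by
  classical
  simp only [rootSet, reducibleSet, twoRootSet, card_filter, mul_sum]
  rw [sum_comm, ← sum_add_distrib]
  refine sum_le_sum fun b _ => ?_
  rw [← card_filter]
  set S := {r ∈ Icc (-(N : ℤ)) N | (monicPoly b).eval r = 0} with hS
  have hroot : ∀ r ∈ S, (monicPoly b).eval r = 0 := fun r hr => (mem_filter.mp hr).2
  rcases S.eq_empty_or_nonempty with h | ⟨r, hr⟩
  · simp [h]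
  rw [if_pos (not_irreducible_of_eval_eq_zero hn (hroot r hr))]
  by_cases h2 : #S ≤ 1
  · omega
  · obtain ⟨r, hr, s, hs, hrs⟩ := one_lt_card.mp (not_le.mp h2)
    rw [if_pos ⟨r, s, hrs, hroot r hr, hroot s hs⟩, mul_one]
    have hle : #S ≤ #(monicPoly b).roots.toFinset := card_le_card fun r hr =>
      Multiset.mem_toFinset.mpr ((mem_roots (monic_monicPoly b).ne_zero).mpr (hroot r hr))
    have := (hle.trans (Multiset.toFinset_card_le _)).trans (card_roots' _)
    rw [natDegree_monicPoly] at this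
    omega

/-- The leading coefficient in the count of reducible polynomials of degree `m + 1`. -/
noncomputable def leadConst (m : ℕ) : ℝ :=
  2 ^ (m + 1) * ((riemannZeta m).re - 1) + 2 ^ m + 2 * (MeasureTheory.volume (slab m)).toReal

lemma exists_abs_sum_card_rootSet_sub_leadConst_le {m : ℕ} (hm : 2 ≤ m) :
    ∃ K : ℝ, 0 ≤ K ∧ ∀ N : ℕ, 2 ≤ N →
      |∑ r ∈ Icc (-(N : ℤ)) N, (#(rootSet (m + 1) r N) : ℝ) - leadConst m * N ^ m| ≤
        K * N ^ (m - 1) * Real.log N := by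
  obtain ⟨K₁, hK₁, h₁⟩ := exists_abs_sum_card_rootSet_sub_le hm
  obtain ⟨K₂, hK₂, h₂⟩ := exists_abs_card_latticeSlab_sub_le (m := m) (by omega)
  set K₀ : ℝ := 2 * m * 2 ^ (m - 1) * 2 ^ (m - 1) with hK₀
  have hK₀' : 0 ≤ K₀ := by positivity
  refine ⟨K₁ + 2 * (K₀ + 2 * K₂), by positivity, fun N hN => ?_⟩
  have e₁ := h₁ N hN
  have e₀ := abs_card_rootSet_zero_sub_le m (N := N) (by omega)
  have e₂ := h₂ N (1 ^ (m + 1)) (by omega) (by simp)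
  have e₃ := h₂ N ((-1) ^ (m + 1)) (by omega) (by simp)
  rw [← card_rootSet_eq_card_latticeSlab m (by norm_num) N] at e₂ e₃
  rw [sum_Icc_neg_eq (fun r => (#(rootSet (m + 1) r N) : ℝ)), ← insert_Ioc_add_one_left_eq_Ioc
    (show 0 < N by omega), sum_insert (by simp)]
  have hlog := one_le_two_mul_log hN
  have hP : (0 : ℝ) ≤ (N : ℝ) ^ (m - 1) := by positivity
  have hmul : (K₀ + 2 * K₂) * (N : ℝ) ^ (m - 1) * 1 ≤
      (K₀ + 2 * K₂) * (N : ℝ) ^ (m - 1) * (2 * Real.log N) := by gcongr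
  rw [← hK₀] at e₀
  rw [leadConst]
  simp only [zero_add, Nat.cast_one]
  rw [abs_le] at e₀ e₁ e₂ e₃ ⊢
  constructor <;> nlinarith

lemma exists_abs_card_reducibleSet_sub_le {m : ℕ} (hm : 2 ≤ m) :
    ∃ K : ℝ, 0 ≤ K ∧ ∀ N : ℕ, 2 ≤ N →
      |(#(reducibleSet (m + 1) N) : ℝ) - leadConst m * N ^ m| ≤
        K * N ^ (m - 1) * Real.log N ^ 2 := by
  obtain ⟨K₁, hK₁, h₁⟩ := exists_abs_sum_card_rootSet_sub_leadConst_le hm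
  obtain ⟨K₂, hK₂, h₂⟩ := exists_card_twoRootSet_le (n := m + 1) (by omega)
  have h₃ : ∀ k, ∃ K : ℝ, 0 ≤ K ∧ (k ∈ Icc 2 ((m + 1) / 2) → ∀ N : ℕ, 2 ≤ N →
      (#(factorSet (m + 1) k N) : ℝ) ≤ K * N ^ (m - 1) * Real.log N ^ 2) := by
    intro k
    by_cases hk : k ∈ Icc 2 ((m + 1) / 2)
    · rw [mem_Icc] at hk
      obtain ⟨K, hK, h⟩ := exists_card_factorSet_le (n := m + 1) hk.1 (by omega)
      exact ⟨K, hK, fun _ => h⟩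
    · exact ⟨0, le_rfl, fun h => absurd h hk⟩
  choose K₃ hK₃ h₃ using h₃
  have hS : 0 ≤ ∑ k ∈ Icc 2 ((m + 1) / 2), K₃ k := sum_nonneg fun k _ => hK₃ k
  refine ⟨2 * K₁ + (m + 1) * K₂ + ∑ k ∈ Icc 2 ((m + 1) / 2), K₃ k, by positivity, fun N hN => ?_⟩
  have e₁ := h₁ N hN
  have e₂ := h₂ N hN
  rw [show m + 1 - 2 = m - 1 by omega] at e₂
  have e₃ : ∑ k ∈ Icc 2 ((m + 1) / 2), (#(factorSet (m + 1) k N) : ℝ) ≤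
      (∑ k ∈ Icc 2 ((m + 1) / 2), K₃ k) * (N ^ (m - 1) * Real.log N ^ 2) := by
    rw [sum_mul]
    exact sum_le_sum fun k hk => (h₃ k hk N hN).trans_eq (by ring)
  have hup : (#(reducibleSet (m + 1) N) : ℝ) ≤ ∑ r ∈ Icc (-(N : ℤ)) N, (#(rootSet (m + 1) r N) : ℝ)
      + ∑ k ∈ Icc 2 ((m + 1) / 2), (#(factorSet (m + 1) k N) : ℝ) := by
    exact_mod_cast card_reducibleSet_le (n := m + 1) (by omega) N
  have hlo : ∑ r ∈ Icc (-(N : ℤ)) N, (#(rootSet (m + 1) r N) : ℝ) ≤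
      #(reducibleSet (m + 1) N) + (m + 1) * #(twoRootSet (m + 1) N) := by
    exact_mod_cast sum_card_rootSet_le (n := m + 1) (by omega) N
  have hlog := one_le_two_mul_log hN
  have hlog0 : 0 ≤ Real.log N := by linarith
  set Q : ℝ := N ^ (m - 1) * Real.log N ^ 2 with hQ
  have hQ0 : 0 ≤ Q := by positivity
  have f₁ : K₁ * N ^ (m - 1) * Real.log N ≤ 2 * K₁ * Q := by
    calc K₁ * N ^ (m - 1) * Real.log N = K₁ * N ^ (m - 1) * Real.log N * 1 := by ring
      _ ≤ K₁ * N ^ (m - 1) * Real.log N * (2 * Real.log N) := by gcongr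
      _ = _ := by rw [hQ]; ring
  have f₂ : (m + 1 : ℝ) * #(twoRootSet (m + 1) N) ≤ (m + 1) * K₂ * Q := by
    calc (m + 1 : ℝ) * #(twoRootSet (m + 1) N) ≤ (m + 1) * (K₂ * N ^ (m - 1) * Real.log N ^ 2) := by
          gcongr
      _ = _ := by rw [hQ]; ring
  have g₁ : 0 ≤ 2 * K₁ * Q := by positivity
  have g₂ : 0 ≤ (m + 1) * K₂ * Q := by positivity
  have g₃ := mul_nonneg hS hQ0
  rw [mul_assoc _ ((N : ℝ) ^ (m - 1)), ← hQ, add_mul, add_mul]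
  rw [abs_le] at e₁ ⊢
  constructor <;> linarith

lemma abs_intCast_le_iff_abs_le_floor {H : ℝ} (hH : 0 ≤ H) (a : ℤ) :
    |(a : ℝ)| ≤ H ↔ |a| ≤ (⌊H⌋₊ : ℤ) := by
  rw [Int.natCast_floor_eq_floor hH, Int.le_floor, Int.cast_abs]

lemma map_monicPoly_rev {n : ℕ} (a : Fin n → ℤ) :
    (monicPoly fun i => a i.rev).map (algebraMap ℤ ℚ) =
      X ^ n + ∑ i : Fin n, C ((a i : ℚ)) * X ^ (n - 1 - (i : ℕ)) := by
  rw [monicPoly, Polynomial.map_add, Polynomial.map_pow, map_X, Polynomial.map_sum,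
    ← Equiv.sum_comp Fin.revPerm]
  congr 1
  refine sum_congr rfl fun i _ => ?_
  rw [Polynomial.map_mul, Polynomial.map_pow, map_X, map_C, Fin.revPerm_apply, Fin.rev_rev,
    Fin.val_rev, eq_intCast, Nat.sub_sub, Nat.add_comm 1]

lemma ncard_reducible_eq {n : ℕ} {H : ℝ} (hH : 0 ≤ H) :
    Set.ncard {a : Fin n → ℤ | (∀ i, |(a i : ℝ)| ≤ H) ∧ ¬ Irreducible
      ((X ^ n + ∑ i : Fin n, C ((a i : ℚ)) * X ^ (n - 1 - (i : ℕ))) : ℚ[X])} =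
      #(reducibleSet n ⌊H⌋₊) := by
  rw [← Set.ncard_coe_finset]
  refine Set.ncard_congr (fun a _ i => a i.rev) ?_ ?_ ?_
  · rintro a ⟨h1, h2⟩
    rw [← map_monicPoly_rev, ← (monic_monicPoly _).irreducible_iff_irreducible_map_fraction_map] at h2
    simp only [reducibleSet, coe_filter, Set.mem_ofPred_eq, mem_box]
    exact ⟨fun i => (abs_intCast_le_iff_abs_le_floor hH _).mp (h1 _), h2⟩
  · intro a a' _ _ h
    funext i
    simpa using congrFun h i.rev
  · intro b hb
    simp only [reducibleSet, coe_filter, Set.mem_ofPred_eq, mem_box] at hb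
    refine ⟨fun i => b i.rev, ⟨fun i => (abs_intCast_le_iff_abs_le_floor hH _).mpr (hb.1 _), ?_⟩, ?_⟩
    · rw [← map_monicPoly_rev, ← (monic_monicPoly _).irreducible_iff_irreducible_map_fraction_map]
      simpa using hb.2
    · simp

lemma exists_abs_card_reducibleSet_floor_sub_le {m : ℕ} (hm : 2 ≤ m) :
    ∃ K : ℝ, 0 < K ∧ ∀ H : ℝ, 2 ≤ H →
      |(#(reducibleSet (m + 1) ⌊H⌋₊) : ℝ) - leadConst m * H ^ m| ≤
        K * H ^ (m - 1) * Real.log H ^ 2 := by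
  obtain ⟨K, hK, h⟩ := exists_abs_card_reducibleSet_sub_le hm
  refine ⟨K + |leadConst m| * m * 4 + 1, by positivity, fun H hH => ?_⟩
  have hN : 2 ≤ ⌊H⌋₊ := Nat.le_floor (by exact_mod_cast hH)
  have hNH : (⌊H⌋₊ : ℝ) ≤ H := Nat.floor_le (by linarith)
  have hHN : H < ⌊H⌋₊ + 1 := Nat.lt_floor_add_one H
  have e := h _ hN
  set N := ⌊H⌋₊
  have hN' : (2 : ℝ) ≤ N := by exact_mod_cast hN
  have hlog := one_le_two_mul_log hN
  have hlogH : Real.log N ≤ Real.log H := Real.log_le_log (by linarith) hNH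
  have hsq : 1 ≤ 4 * Real.log H ^ 2 := by nlinarith
  have hlog0 : 0 ≤ Real.log N := by linarith
  have f₁ : K * N ^ (m - 1) * Real.log N ^ 2 ≤ K * H ^ (m - 1) * Real.log H ^ 2 := by gcongr
  have f₂ : |(N : ℝ) ^ m - H ^ m| ≤ m * H ^ (m - 1) := by
    refine (abs_pow_sub_pow_le ..).trans ?_
    rw [abs_of_nonneg (show (0 : ℝ) ≤ N by linarith), abs_of_nonneg (show 0 ≤ H by linarith),
      max_eq_right hNH]
    have : |(N : ℝ) - H| ≤ 1 := abs_le.mpr ⟨by linarith, by linarith⟩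
    have hH0 : 0 ≤ H := by linarith
    calc |(N : ℝ) - H| * m * H ^ (m - 1) ≤ 1 * m * H ^ (m - 1) := by gcongr
      _ = _ := by ring
  have f₃ : |leadConst m * N ^ m - leadConst m * H ^ m| ≤
      |leadConst m| * m * 4 * H ^ (m - 1) * Real.log H ^ 2 := by
    rw [← mul_sub, abs_mul]
    have hH0 : 0 ≤ H := by linarith
    calc |leadConst m| * |(N : ℝ) ^ m - H ^ m| ≤ |leadConst m| * (m * H ^ (m - 1)) * 1 := by
          rw [mul_one]; gcongr
      _ ≤ |leadConst m| * (m * H ^ (m - 1)) * (4 * Real.log H ^ 2) := by gcongr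
      _ = _ := by ring
  have f₄ : 0 ≤ H ^ (m - 1) * Real.log H ^ 2 := by
    have hH0 : 0 ≤ H := by linarith
    positivity
  calc |(#(reducibleSet (m + 1) N) : ℝ) - leadConst m * H ^ m|
      ≤ |(#(reducibleSet (m + 1) N) : ℝ) - leadConst m * N ^ m| +
          |leadConst m * N ^ m - leadConst m * H ^ m| := abs_sub_le _ _ _
    _ ≤ _ := by linarith

end ReducibleCount

/-- Asymptotic count of monic, reducible degree-`n` integer polynomials with coefficients
bounded by `H`: `R_n(H) = c_n H^{n-1} + O(H^{n-2} (log H)²)`, where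
`c_n = 2ⁿ(ζ(n−1) − 1) + 2^{n−1} + 2k_n` and `k_n` is the volume of the region
`{|x_i| ≤ 1, |x₁ + ⋯ + x_{n−1}| ≤ 1}` in `ℝ^{n−1}`. -/
theorem reducible_count (n : ℕ) (hn : 3 ≤ n) :
    ∃ K : ℝ, 0 < K ∧ ∀ H : ℝ, 2 ≤ H →
      |(Set.ncard {a : Fin n → ℤ | (∀ i, |(a i : ℝ)| ≤ H) ∧
          ¬ Irreducible
            ((X ^ n + ∑ i : Fin n, C ((a i : ℚ)) * X ^ (n - 1 - (i : ℕ))) : ℚ[X])} : ℝ)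
        - ((2 : ℝ) ^ n * ((riemannZeta (n - 1)).re - 1) + 2 ^ (n - 1)
            + 2 * (MeasureTheory.volume
                {x : Fin (n - 1) → ℝ | (∀ i, |x i| ≤ 1) ∧ |∑ i, x i| ≤ 1}).toReal)
          * H ^ (n - 1)|
      ≤ K * H ^ (n - 2) * (Real.log H) ^ 2 := by
  obtain ⟨m, rfl⟩ : ∃ m, n = m + 1 := ⟨n - 1, by omega⟩
  obtain ⟨K, hK, h⟩ := ReducibleCount.exists_abs_card_reducibleSet_floor_sub_le (m := m) (by omega)
  refine ⟨K, hK, fun H hH => ?_⟩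
  rw [ReducibleCount.ncard_reducible_eq (by linarith), Nat.cast_add_one, add_sub_cancel_right]
  exact h H hH
end

section
/- Let b and t be positive integers with b ≡ 0 (mod 4), t ≡ 1 (mod 4), and b > 2t. Then the polynomial f(X) = X⁴ + bX² + t² is irreducible over ℚ. -/
open Polynomial

theorem Polynomial.Monic.eq_quadratic {R : Type*} [CommRing R] {p : R[X]} (hp : p.Monic)
    (hdeg : p.natDegree = 2) : p = X ^ 2 + C (p.coeff 1) * X + C (p.coeff 0) := by
  conv_lhs => rw [hp.as_sum, hdeg]
  simp [Finset.sum_range_succ]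
  ring

theorem quadratic_mul_quadratic_eq_biquadratic {R : Type*} [CommRing R] {a c d e b s : R}
    (h : (X ^ 2 + C a * X + C c) * (X ^ 2 + C d * X + C e) = X ^ 4 + C b * X ^ 2 + C s) :
    a + d = 0 ∧ c + e + a * d = b ∧ a * e + c * d = 0 ∧ c * e = s := by
  have h' : (X ^ 2 + C a * X + C c) * (X ^ 2 + C d * X + C e) =
      X ^ 4 + C (a + d) * X ^ 3 + C (c + e + a * d) * X ^ 2 + C (a * e + c * d) * X
        + C (c * e) := by
    simp only [C_add, C_mul]
    ring
  rw [h'] at h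
  refine ⟨?_, ?_, ?_, ?_⟩
  · simpa [coeff_X, coeff_C, -map_add, -map_mul] using congrArg (fun p => coeff p 3) h
  · simpa [coeff_X, coeff_C, -map_add, -map_mul] using congrArg (fun p => coeff p 2) h
  · simpa [coeff_X, coeff_C, -map_add, -map_mul] using congrArg (fun p => coeff p 1) h
  · simpa [coeff_X, coeff_C, -map_add, -map_mul] using congrArg (fun p => coeff p 0) h

theorem Int.add_emod_four_of_mul_emod_four_eq_one {c e : ℤ} (h : c * e % 4 = 1) :
    (c + e) % 4 = 2 := by
  have hc : c % 4 = 0 ∨ c % 4 = 1 ∨ c % 4 = 2 ∨ c % 4 = 3 := by omega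
  have he : e % 4 = 0 ∨ e % 4 = 1 ∨ e % 4 = 2 ∨ e % 4 = 3 := by omega
  rcases hc with hc | hc | hc | hc <;> rcases he with he | he | he | he <;>
    simp [Int.mul_emod, Int.add_emod, hc, he] at h ⊢

theorem biquadratic_no_quadratic_factorization {a c d e b t : ℤ} (ht : 0 < t)
    (hb4 : b % 4 = 0) (ht4 : t % 4 = 1) (hbt : b > 2 * t) (h3 : a + d = 0)
    (h2 : c + e + a * d = b) (h1 : a * e + c * d = 0) (h0 : c * e = t ^ 2) : False := by
  obtain rfl : d = -a := by linarith
  have hprod : a * (e - c) = 0 := by linarith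
  rcases mul_eq_zero.mp hprod with rfl | hec
  · have hmod : c * e % 4 = 1 := by simp [h0, pow_two, Int.mul_emod, ht4]
    have := Int.add_emod_four_of_mul_emod_four_eq_one hmod
    simp only [zero_mul, add_zero] at h2
    omega
  · obtain rfl : e = c := by linarith
    have hsq : e ^ 2 = t ^ 2 := by linarith [pow_two e]
    rcases sq_eq_sq_iff_eq_or_eq_neg.mp hsq with rfl | rfl <;> nlinarith [sq_nonneg a]

theorem biquadratic_irreducible_int {b t : ℤ} (hb : 0 < b) (ht : 0 < t)
    (hb4 : b % 4 = 0) (ht4 : t % 4 = 1) (hbt : b > 2 * t) :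
    Irreducible (X ^ 4 + C b * X ^ 2 + C (t ^ 2) : ℤ[X]) := by
  have hdeg : (X ^ 4 + C b * X ^ 2 + C (t ^ 2) : ℤ[X]).natDegree = 4 := by compute_degree!
  have hmonic : (X ^ 4 + C b * X ^ 2 + C (t ^ 2) : ℤ[X]).Monic := by monicity!
  have hne : (X ^ 4 + C b * X ^ 2 + C (t ^ 2) : ℤ[X]) ≠ 1 := by
    intro h
    rw [h, natDegree_one] at hdeg
    omega
  rw [hmonic.irreducible_iff_lt_natDegree_lt hne]
  rintro q hq hqdeg ⟨r, hr⟩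
  rw [hdeg, Finset.mem_Ioc] at hqdeg
  have hrmonic : r.Monic := hq.of_mul_monic_left (hr ▸ hmonic)
  have hdegs : q.natDegree + r.natDegree = 4 := by
    rw [← hq.natDegree_mul hrmonic, ← hr, hdeg]
  obtain hq1 | hq2 : q.natDegree = 1 ∨ q.natDegree = 2 := by omega
  · have hroot := congrArg (eval (-q.coeff 0)) hr
    rw [eval_mul, hq.eq_X_add_C hq1] at hroot
    simp at hroot
    nlinarith [pow_pos ht 2, sq_nonneg (q.coeff 0 ^ 2), mul_nonneg hb.le (sq_nonneg (q.coeff 0))]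
  · rw [hq.eq_quadratic hq2, hrmonic.eq_quadratic (by omega)] at hr
    obtain ⟨h3, h2, h1, h0⟩ := quadratic_mul_quadratic_eq_biquadratic hr.symm
    exact biquadratic_no_quadratic_factorization ht hb4 ht4 hbt h3 h2 h1 h0

/-- For positive integers `b ≡ 0 (mod 4)`, `t ≡ 1 (mod 4)` with `b > 2t`, the polynomial
`X⁴ + bX² + t²` is irreducible over `ℚ`. -/
theorem biquadratic_irreducible (b t : ℤ) (hb : 0 < b) (ht : 0 < t)
    (hb4 : b % 4 = 0) (ht4 : t % 4 = 1) (hbt : b > 2 * t) :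
    Irreducible (X ^ 4 + C (b : ℚ) * X ^ 2 + C ((t : ℚ) ^ 2) : ℚ[X]) := by
  have hmonic : (X ^ 4 + C b * X ^ 2 + C (t ^ 2) : ℤ[X]).Monic := by monicity!
  simpa using (hmonic.irreducible_iff_irreducible_map_fraction_map (K := ℚ)).mp
    (biquadratic_irreducible_int hb ht hb4 ht4 hbt)
end
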